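/- arXiv:2202.08575 — 7 statements merged into one kernel-verified Lean document; each statement's English description precedes it below -/
import Mathlib

section
/- Let T : M → A be an O-operator on an associative conformal algebra A with respect to a conformal bimodule M. Define λ-actions of M_ass on A by m ·_λ a = T(m)_λ a − T(m_λ a) and a ·_λ m = a_λ T(m) − T(a_λ m). Then these actions are conformal sesquilinear and make A a conformal bimodule over the associative conformal algebra M_ass; in particular m ·_λ (n ·_μ a) = (m ⋆_λ n) ·_{λ+μ} a, (a ·_λ m) ·_{λ+μ} n = a ·_λ (m ⋆_μ n), and m ·_λ (a ·_μ n) = (m ·_λ a) ·_{λ+μ} n for all a ∈ A and m, n ∈ M. -/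
open Polynomial

noncomputable section

/-!  Framework for associative conformal algebras over `ℂ[∂]`.

A `ℂ[∂]`-module is modelled as a module over `ℂ[X]` (with the variable `X`
playing the role of `∂`), together with a compatible `ℂ`-action.  A polynomial
`Σᵢ λ^i cᵢ` in a formal variable `λ` with coefficients in a module `V` is
recorded by its finitely supported family of coefficients `ℕ →₀ V`.  Identities
between such polynomials are stated through their evaluations at every
`lam : ℂ`; over the infinite field `ℂ` this is equivalent to the corresponding
polynomial identities. -/

/-- Evaluation at `lam : ℂ` of a `V`-valued polynomial given by its coefficients. -/
def cev {V : Type*} [AddCommMonoid V] [Module ℂ V] (lam : ℂ) (p : ℕ →₀ V) : V :=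
  p.sum fun i c => lam ^ i • c

/-- Substitution `μ ↦ -λ - ∂` in the polynomial `μ ↦ Σᵢ μ^i cᵢ`, where `∂ = X`
acts through the `ℂ[∂]`-module structure. -/
def csub {V : Type*} [AddCommMonoid V] [Module ℂ[X] V] (lam : ℂ) (p : ℕ →₀ V) : V :=
  p.sum fun i c => ((-(C lam) - X) ^ i : ℂ[X]) • c

/-- A `ℂ`-bilinear conformal sesquilinear λ-product `A × B → M[λ]`, recorded by
the coefficient family `coeff a b : ℕ →₀ M` of the polynomial `a_λ b`. -/
structure ConfBilin (A B M : Type*)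
    [AddCommGroup A] [Module ℂ A] [Module ℂ[X] A]
    [AddCommGroup B] [Module ℂ B] [Module ℂ[X] B]
    [AddCommGroup M] [Module ℂ M] [Module ℂ[X] M] where
  coeff : A → B → ℕ →₀ M
  add_left : ∀ a a' b, coeff (a + a') b = coeff a b + coeff a' b
  smul_left : ∀ (c : ℂ) a b, coeff (c • a) b = c • coeff a b
  add_right : ∀ a b b', coeff a (b + b') = coeff a b + coeff a b'
  smul_right : ∀ (c : ℂ) a b, coeff a (c • b) = c • coeff a b
  /-- `(∂a)_λ b = -λ (a_λ b)` -/
  sesq_left : ∀ (lam : ℂ) (a : A) (b : B),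
    cev lam (coeff ((X : ℂ[X]) • a) b) = (-lam) • cev lam (coeff a b)
  /-- `a_λ (∂b) = (∂ + λ) (a_λ b)` -/
  sesq_right : ∀ (lam : ℂ) (a : A) (b : B),
    cev lam (coeff a ((X : ℂ[X]) • b)) =
      (X : ℂ[X]) • cev lam (coeff a b) + lam • cev lam (coeff a b)

namespace ConfBilin

variable {A B M : Type*}
  [AddCommGroup A] [Module ℂ A] [Module ℂ[X] A]
  [AddCommGroup B] [Module ℂ B] [Module ℂ[X] B]
  [AddCommGroup M] [Module ℂ M] [Module ℂ[X] M]

/-- `a_lam b` : the λ-product evaluated at `lam : ℂ`. -/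
def mul (f : ConfBilin A B M) (lam : ℂ) (a : A) (b : B) : M := cev lam (f.coeff a b)

/-- `a_{-λ-∂} b` : the λ-product with `-λ-∂` substituted for the variable. -/
def mulNeg (f : ConfBilin A B M) (lam : ℂ) (a : A) (b : B) : M := csub lam (f.coeff a b)

end ConfBilin

/-- An associative conformal algebra structure on the `ℂ[∂]`-module `A`. -/
structure AssocConfAlg (A : Type*)
    [AddCommGroup A] [Module ℂ A] [Module ℂ[X] A] extends ConfBilin A A A where
  /-- `(a_λ b)_{λ+μ} c = a_λ (b_μ c)` -/
  assoc : ∀ (lam mu : ℂ) (a b c : A),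
    toConfBilin.mul (lam + mu) (toConfBilin.mul lam a b) c =
      toConfBilin.mul lam a (toConfBilin.mul mu b c)

namespace AssocConfAlg

variable {A : Type*} [AddCommGroup A] [Module ℂ A] [Module ℂ[X] A]

def mul (θ : AssocConfAlg A) : ℂ → A → A → A := θ.toConfBilin.mul

def mulNeg (θ : AssocConfAlg A) : ℂ → A → A → A := θ.toConfBilin.mulNeg

end AssocConfAlg

/-- A conformal bimodule `M` over the associative conformal algebra `(A, θ)`,
with left action `l` and right action `r`. -/
structure ConfBimod {A : Type*} [AddCommGroup A] [Module ℂ A] [Module ℂ[X] A]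
    (θ : AssocConfAlg A) (M : Type*)
    [AddCommGroup M] [Module ℂ M] [Module ℂ[X] M] where
  l : ConfBilin A M M
  r : ConfBilin M A M
  /-- `(a_λ b)_{λ+μ} m = a_λ (b_μ m)` -/
  assoc_ll : ∀ (lam mu : ℂ) (a b : A) (m : M),
    l.mul (lam + mu) (θ.mul lam a b) m = l.mul lam a (l.mul mu b m)
  /-- `(m_λ a)_{λ+μ} b = m_λ (a_μ b)` -/
  assoc_rr : ∀ (lam mu : ℂ) (m : M) (a b : A),
    r.mul (lam + mu) (r.mul lam m a) b = r.mul lam m (θ.mul mu a b)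
  /-- `(a_λ m)_{λ+μ} b = a_λ (m_μ b)` -/
  assoc_lr : ∀ (lam mu : ℂ) (a : A) (m : M) (b : A),
    r.mul (lam + mu) (l.mul lam a m) b = l.mul lam a (r.mul mu m b)

section Defs

variable {A M : Type*}
  [AddCommGroup A] [Module ℂ A] [Module ℂ[X] A]
  [AddCommGroup M] [Module ℂ M] [Module ℂ[X] M]

/-- `T : M → A` is an `𝒪`-operator on `(A, θ)` with respect to the conformal
bimodule `ρ` : `T(m)_λ T(n) = T (T(m)_λ n + m_λ T(n))`. -/
def IsOOperator {θ : AssocConfAlg A} (ρ : ConfBimod θ M) (T : M → A) : Prop :=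
  ∀ (lam : ℂ) (m n : M),
    θ.mul lam (T m) (T n) = T (ρ.l.mul lam (T m) n + ρ.r.mul lam m (T n))

/-- `N : A → A` is a Nijenhuis operator :
`N(a)_λ N(b) = N (N(a)_λ b + a_λ N(b) - N(a_λ b))`. -/
def IsNijenhuis (θ : AssocConfAlg A) (N : A → A) : Prop :=
  ∀ (lam : ℂ) (a b : A),
    θ.mul lam (N a) (N b) =
      N (θ.mul lam (N a) b + θ.mul lam a (N b) - N (θ.mul lam a b))

/-- `T : A → A` is a Rota-Baxter operator of weight `q`. -/
def IsRotaBaxterWt (θ : AssocConfAlg A) (q : ℂ) (T : A → A) : Prop :=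
  ∀ (lam : ℂ) (a b : A),
    θ.mul lam (T a) (T b) =
      T (θ.mul lam (T a) b + θ.mul lam a (T b) + q • θ.mul lam a b)

/-- The Hochschild 2-cocycle identity for an `M`-valued λ-bilinear map `ψ` on `A`. -/
def IsTwoCocycleFun {θ : AssocConfAlg A} (ρ : ConfBimod θ M)
    (ψ : ℂ → A → A → M) : Prop :=
  ∀ (lam mu : ℂ) (a b c : A),
    ρ.l.mul lam a (ψ mu b c) - ψ (lam + mu) (θ.mul lam a b) c
      + ψ lam a (θ.mul mu b c) - ρ.r.mul (lam + mu) (ψ lam a b) c = 0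

/-- `φ` is a 2-cocycle in `C²(A, M)`. -/
def IsTwoCocycle {θ : AssocConfAlg A} (ρ : ConfBimod θ M)
    (φ : ConfBilin A A M) : Prop :=
  IsTwoCocycleFun ρ φ.mul

/-- `T : M → A` is a `φ`-twisted Rota-Baxter operator :
`T(m)_λ T(n) = T (T(m)_λ n + m_λ T(n) + φ_λ(T(m), T(n)))`. -/
def IsTwistedRB {θ : AssocConfAlg A} (ρ : ConfBimod θ M) (φ : ConfBilin A A M)
    (T : M → A) : Prop :=
  ∀ (lam : ℂ) (m n : M),
    θ.mul lam (T m) (T n) =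
      T (ρ.l.mul lam (T m) n + ρ.r.mul lam m (T n) + φ.mul lam (T m) (T n))

/-- The λ-product of the semidirect product `A ⊕₀ M`. -/
def sdMul {θ : AssocConfAlg A} (ρ : ConfBimod θ M) (lam : ℂ) (x y : A × M) : A × M :=
  (θ.mul lam x.1 y.1, ρ.l.mul lam x.1 y.2 + ρ.r.mul lam x.2 y.1)

/-- The λ-product of the twisted semidirect product `A ⊕_ψ M`. -/
def sdMulTw {θ : AssocConfAlg A} (ρ : ConfBimod θ M) (ψ : ℂ → A → A → M)
    (lam : ℂ) (x y : A × M) : A × M :=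
  (θ.mul lam x.1 y.1, ρ.l.mul lam x.1 y.2 + ρ.r.mul lam x.2 y.1 + ψ lam x.1 y.1)

/-- The lift `T̂(a, m) = (T(m), 0)` of a map `T : M → A` to `A ⊕ M`. -/
def liftMap (T : M → A) (x : A × M) : A × M := (T x.2, 0)

/-- The λ-product `m ⋆_λ n = T(m)_λ n + m_λ T(n)` on `M` induced by an `𝒪`-operator. -/
def oStar {θ : AssocConfAlg A} (ρ : ConfBimod θ M) (T : M → A)
    (lam : ℂ) (m n : M) : M :=
  ρ.l.mul lam (T m) n + ρ.r.mul lam m (T n)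

/-- The left λ-action `m ·_λ a = T(m)_λ a - T(m_λ a)` of `M_ass` on `A`. -/
def oDotL {θ : AssocConfAlg A} (ρ : ConfBimod θ M) (T : M → A)
    (lam : ℂ) (m : M) (a : A) : A :=
  θ.mul lam (T m) a - T (ρ.r.mul lam m a)

/-- The right λ-action `a ·_λ m = a_λ T(m) - T(a_λ m)` of `M_ass` on `A`. -/
def oDotR {θ : AssocConfAlg A} (ρ : ConfBimod θ M) (T : M → A)
    (lam : ℂ) (a : A) (m : M) : A :=
  θ.mul lam a (T m) - T (ρ.l.mul lam a m)

/-- `m ⋆^φ_λ n = T(m)_λ n + m_λ T(n) + φ_λ(T(m), T(n))`. -/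
def twStar {θ : AssocConfAlg A} (ρ : ConfBimod θ M) (φ : ConfBilin A A M)
    (T : M → A) (lam : ℂ) (m n : M) : M :=
  ρ.l.mul lam (T m) n + ρ.r.mul lam m (T n) + φ.mul lam (T m) (T n)

/-- `m ·^φ_λ a = T(m)_λ a - T (m_λ a + φ_λ(T(m), a))`. -/
def twDotL {θ : AssocConfAlg A} (ρ : ConfBimod θ M) (φ : ConfBilin A A M)
    (T : M → A) (lam : ℂ) (m : M) (a : A) : A :=
  θ.mul lam (T m) a - T (ρ.r.mul lam m a + φ.mul lam (T m) a)

/-- `a ·^φ_λ m = a_λ T(m) - T (a_λ m + φ_λ(a, T(m)))`. -/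
def twDotR {θ : AssocConfAlg A} (ρ : ConfBimod θ M) (φ : ConfBilin A A M)
    (T : M → A) (lam : ℂ) (a : A) (m : M) : A :=
  θ.mul lam a (T m) - T (ρ.l.mul lam a m + φ.mul lam a (T m))

/-- The map `(a, m) ↦ (a, m - h(a))` on `A ⊕ M`. -/
def shiftMap (h : A → M) (p : A × M) : A × M := (p.1, p.2 - h p.1)

/-- The deformed λ-product `a ∘^N_λ b = N(a)_λ b + a_λ N(b) - N(a_λ b)`. -/
def nijProd (θ : AssocConfAlg A) (N : A → A) (lam : ℂ) (a b : A) : A :=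
  θ.mul lam (N a) b + θ.mul lam a (N b) - N (θ.mul lam a b)

end Defs

/-- A dendriform conformal algebra. -/
structure DendriformConfAlg (E : Type*)
    [AddCommGroup E] [Module ℂ E] [Module ℂ[X] E] where
  succ : ConfBilin E E E
  prec : ConfBilin E E E
  dend1 : ∀ (lam mu : ℂ) (a b c : E),
    succ.mul lam a (succ.mul mu b c) =
      succ.mul (lam + mu) (succ.mul lam a b + prec.mul lam a b) c
  dend2 : ∀ (lam mu : ℂ) (a b c : E),
    prec.mul (lam + mu) (prec.mul lam a b) c =
      prec.mul lam a (succ.mul mu b c + prec.mul mu b c)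
  dend3 : ∀ (lam mu : ℂ) (a b c : E),
    prec.mul (lam + mu) (succ.mul lam a b) c = succ.mul lam a (prec.mul mu b c)

/-- The product `a ∘_λ b = a ≻_λ b - b ≺_{-λ-∂} a` of a dendriform conformal algebra. -/
def dendComp {E : Type*} [AddCommGroup E] [Module ℂ E] [Module ℂ[X] E]
    (D : DendriformConfAlg E) (lam : ℂ) (a b : E) : E :=
  D.succ.mul lam a b - D.prec.mulNeg lam b a

/-- A conformal NS-algebra. -/
structure NSConfAlg (E : Type*)
    [AddCommGroup E] [Module ℂ E] [Module ℂ[X] E] where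
  succ : ConfBilin E E E
  prec : ConfBilin E E E
  vee : ConfBilin E E E
  ns1 : ∀ (lam mu : ℂ) (x y z : E),
    succ.mul lam x (succ.mul mu y z) =
      succ.mul (lam + mu) (succ.mul lam x y + prec.mul lam x y + vee.mul lam x y) z
  ns2 : ∀ (lam mu : ℂ) (x y z : E),
    prec.mul lam x (succ.mul mu y z + prec.mul mu y z + vee.mul mu y z) =
      prec.mul (lam + mu) (prec.mul lam x y) z
  ns3 : ∀ (lam mu : ℂ) (x y z : E),
    succ.mul lam x (prec.mul mu y z) = prec.mul (lam + mu) (succ.mul lam x y) z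
  ns4 : ∀ (lam mu : ℂ) (x y z : E),
    succ.mul lam x (vee.mul mu y z)
        - vee.mul (lam + mu) (succ.mul lam x y + prec.mul lam x y + vee.mul lam x y) z =
      prec.mul (lam + mu) (vee.mul lam x y) z
        - vee.mul lam x (succ.mul mu y z + prec.mul mu y z + vee.mul mu y z)

/-- `x ×_λ y = x ≻_λ y + x ≺_λ y + x ∨_λ y` in a conformal NS-algebra. -/
def nsTimes {E : Type*} [AddCommGroup E] [Module ℂ E] [Module ℂ[X] E]
    (NS : NSConfAlg E) (lam : ℂ) (x y : E) : E :=
  NS.succ.mul lam x y + NS.prec.mul lam x y + NS.vee.mul lam x y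

theorem cev_add' {V : Type*} [AddCommGroup V] [Module ℂ V] (lam : ℂ) (p q : ℕ →₀ V) :
    cev lam (p + q) = cev lam p + cev lam q := by
  unfold cev
  exact Finsupp.sum_add_index' (by simp) (by simp)

theorem ConfBilin.mul_add_l {A B M : Type*}
    [AddCommGroup A] [Module ℂ A] [Module ℂ[X] A]
    [AddCommGroup B] [Module ℂ B] [Module ℂ[X] B]
    [AddCommGroup M] [Module ℂ M] [Module ℂ[X] M]
    (f : ConfBilin A B M) (lam : ℂ) (a a' : A) (b : B) :
    f.mul lam (a + a') b = f.mul lam a b + f.mul lam a' b := by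
  simp only [ConfBilin.mul, f.add_left, cev_add']

theorem ConfBilin.mul_add_r {A B M : Type*}
    [AddCommGroup A] [Module ℂ A] [Module ℂ[X] A]
    [AddCommGroup B] [Module ℂ B] [Module ℂ[X] B]
    [AddCommGroup M] [Module ℂ M] [Module ℂ[X] M]
    (f : ConfBilin A B M) (lam : ℂ) (a : A) (b b' : B) :
    f.mul lam a (b + b') = f.mul lam a b + f.mul lam a b' := by
  simp only [ConfBilin.mul, f.add_right, cev_add']

theorem ConfBilin.mul_sub_l {A B M : Type*}
    [AddCommGroup A] [Module ℂ A] [Module ℂ[X] A]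
    [AddCommGroup B] [Module ℂ B] [Module ℂ[X] B]
    [AddCommGroup M] [Module ℂ M] [Module ℂ[X] M]
    (f : ConfBilin A B M) (lam : ℂ) (a a' : A) (b : B) :
    f.mul lam (a - a') b = f.mul lam a b - f.mul lam a' b := by
  rw [eq_sub_iff_add_eq, ← f.mul_add_l, sub_add_cancel]

theorem ConfBilin.mul_sub_r {A B M : Type*}
    [AddCommGroup A] [Module ℂ A] [Module ℂ[X] A]
    [AddCommGroup B] [Module ℂ B] [Module ℂ[X] B]
    [AddCommGroup M] [Module ℂ M] [Module ℂ[X] M]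
    (f : ConfBilin A B M) (lam : ℂ) (a : A) (b b' : B) :
    f.mul lam a (b - b') = f.mul lam a b - f.mul lam a b' := by
  rw [eq_sub_iff_add_eq, ← f.mul_add_r, sub_add_cancel]

/-- for an `𝒪`-operator `T`, the actions
`m ·_λ a = T(m)_λ a - T(m_λ a)` and `a ·_λ m = a_λ T(m) - T(a_λ m)` are
conformal sesquilinear and make `A` a conformal bimodule over `M_ass`. -/
theorem stmt2 {A M : Type*}
    [AddCommGroup A] [Module ℂ A] [Module ℂ[X] A] [IsScalarTower ℂ ℂ[X] A]
    [AddCommGroup M] [Module ℂ M] [Module ℂ[X] M] [IsScalarTower ℂ ℂ[X] M]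
    (θ : AssocConfAlg A) (ρ : ConfBimod θ M) (T : M →ₗ[ℂ[X]] A)
    (hT : IsOOperator ρ ⇑T) :
    (∀ (lam : ℂ) (m : M) (a : A),
        oDotL ρ (⇑T) lam ((X : ℂ[X]) • m) a = (-lam) • oDotL ρ (⇑T) lam m a) ∧
    (∀ (lam : ℂ) (m : M) (a : A),
        oDotL ρ (⇑T) lam m ((X : ℂ[X]) • a) =
          (X : ℂ[X]) • oDotL ρ (⇑T) lam m a + lam • oDotL ρ (⇑T) lam m a) ∧
    (∀ (lam : ℂ) (a : A) (m : M),
        oDotR ρ (⇑T) lam ((X : ℂ[X]) • a) m = (-lam) • oDotR ρ (⇑T) lam a m) ∧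
    (∀ (lam : ℂ) (a : A) (m : M),
        oDotR ρ (⇑T) lam a ((X : ℂ[X]) • m) =
          (X : ℂ[X]) • oDotR ρ (⇑T) lam a m + lam • oDotR ρ (⇑T) lam a m) ∧
    (∀ (lam mu : ℂ) (m n : M) (a : A),
        oDotL ρ (⇑T) lam m (oDotL ρ (⇑T) mu n a) =
          oDotL ρ (⇑T) (lam + mu) (oStar ρ (⇑T) lam m n) a) ∧
    (∀ (lam mu : ℂ) (a : A) (m n : M),
        oDotR ρ (⇑T) (lam + mu) (oDotR ρ (⇑T) lam a m) n =
          oDotR ρ (⇑T) lam a (oStar ρ (⇑T) mu m n)) ∧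
    (∀ (lam mu : ℂ) (m : M) (a : A) (n : M),
        oDotL ρ (⇑T) lam m (oDotR ρ (⇑T) mu a n) =
          oDotR ρ (⇑T) (lam + mu) (oDotL ρ (⇑T) lam m a) n) := by
  have hs : ∀ (c : ℂ) (m : M), T (c • m) = c • T m := fun c m => T.map_smul_of_tower c m
  have hO : ∀ (lam : ℂ) (m n : M), θ.toConfBilin.mul lam (T m) (T n) =
      T (ρ.l.mul lam (T m) n) + T (ρ.r.mul lam m (T n)) := by
    intro lam m n
    rw [← map_add]
    exact hT lam m n
  have ha := θ.assoc
  have hll := ρ.assoc_ll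
  have hrr := ρ.assoc_rr
  have hlr := ρ.assoc_lr
  simp only [AssocConfAlg.mul] at hll hrr
  simp only [oDotL, oDotR, oStar, AssocConfAlg.mul]
  refine ⟨?_, ?_, ?_, ?_, ?_, ?_, ?_⟩
  · intro lam m a
    simp only [ConfBilin.mul, map_smul, ConfBilin.sesq_left, hs, smul_sub]
  · intro lam m a
    simp only [ConfBilin.mul, map_smul, ConfBilin.sesq_right, hs, smul_sub, map_add]
    abel
  · intro lam a m
    simp only [ConfBilin.mul, map_smul, ConfBilin.sesq_left, hs, smul_sub]
  · intro lam a m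
    simp only [ConfBilin.mul, map_smul, ConfBilin.sesq_right, hs, smul_sub, map_add]
    abel
  · intro lam mu m n a
    simp only [ConfBilin.mul_add_l, ConfBilin.mul_sub_r, map_add, map_sub, ← ha, ← hrr, hlr, hO]
    abel
  · intro lam mu a m n
    simp only [ConfBilin.mul_add_r, ConfBilin.mul_sub_l, map_add, map_sub, ha, hll, hlr, hO]
    abel
  · intro lam mu m a n
    simp only [ConfBilin.mul_sub_r, ConfBilin.mul_sub_l, map_add, map_sub, ha, hll, hrr, hlr, hO]
    abel
end
end

section
/- Let T : M → A be an O-operator on an associative conformal algebra A with respect to a conformal bimodule M, and let Ω : A → M be a derivation, i.e., a ℂ[∂]-module homomorphism with Ω(a_λ b) = Ω(a)_λ b + a_λ Ω(b), satisfying Ω(a) ⋆_λ Ω(b) = Ω(Ω(a) ·_λ b + a ·_λ Ω(b)) for all a, b ∈ A, where m ·_λ a = T(m)_λ a − T(m_λ a) and a ·_λ m = a_λ T(m) − T(a_λ m). Then: (1) the composition TΩ : A → A satisfies TΩ(a)_λ TΩ(b) = TΩ(TΩ(a)_λ b + a_λ TΩ(b) − TΩ(a_λ b)) for all a, b ∈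 A; (2) the composition TΩT : M → A is an O-operator on A with respect to M. -/
open Polynomial

noncomputable section

/-- if `T` is an `𝒪`-operator and `Ω : A → M` a derivation with
`Ω(a) ⋆_λ Ω(b) = Ω(Ω(a) ·_λ b + a ·_λ Ω(b))`, then (1) `TΩ` satisfies the
Nijenhuis identity on `A`, and (2) `TΩT` is again an `𝒪`-operator. -/
theorem stmt3 {A M : Type*}
    [AddCommGroup A] [Module ℂ A] [Module ℂ[X] A] [IsScalarTower ℂ ℂ[X] A]
    [AddCommGroup M] [Module ℂ M] [Module ℂ[X] M] [IsScalarTower ℂ ℂ[X] M]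
    (θ : AssocConfAlg A) (ρ : ConfBimod θ M) (T : M →ₗ[ℂ[X]] A)
    (hT : IsOOperator ρ ⇑T) (Ω : A →ₗ[ℂ[X]] M)
    (hder : ∀ (lam : ℂ) (a b : A),
      Ω (θ.mul lam a b) = ρ.r.mul lam (Ω a) b + ρ.l.mul lam a (Ω b))
    (hcond : ∀ (lam : ℂ) (a b : A),
      oStar ρ (⇑T) lam (Ω a) (Ω b) =
        Ω (oDotL ρ (⇑T) lam (Ω a) b + oDotR ρ (⇑T) lam a (Ω b))) :
    IsNijenhuis θ (fun a => T (Ω a)) ∧ IsOOperator ρ (fun m => T (Ω (T m))) := by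
  have h1 : IsNijenhuis θ (fun a => T (Ω a)) := by
    intro lam a b
    have h := hT lam (Ω a) (Ω b)
    have hc := hcond lam a b
    unfold oStar oDotL oDotR at hc
    rw [hc] at h
    simp only
    rw [h, hder]
    congr 2
    rw [map_add]
    abel
  refine ⟨h1, ?_⟩
  intro lam m n
  have h := h1 lam (T m) (T n)
  simp only at h ⊢
  rw [h, hder, hT lam (Ω (T m)) n, hT lam m (Ω (T n))]
  congr 2
  simp only [map_add]
  abel
end
end

section
/- Let (E, ≻_λ, ≺_λ) be a dendriform conformal algebra. Define a ∘_λ b = a ≻_λ b − b ≺_{−λ−∂} a. Then (E, ∘_λ) is a left-symmetric conformal algebra, i.e., ∘_λ is conformal sesquilinear and (a ∘_λ b) ∘_{λ+μ} c − a ∘_λ (b ∘_μ c) = (b ∘_μ a) ∘_{λ+μ} c − b ∘_μ (a ∘_λ c) for all a, b, c ∈ E. -/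
open Polynomial

noncomputable section

set_option linter.unusedSectionVars false

namespace Stmt5Aux

section
variable {E : Type*} [AddCommGroup E] [Module ℂ E] [Module ℂ[X] E]

def pev (r : ℂ[X]) : (ℕ →₀ E) →+ E :=
  Finsupp.liftAddHom fun i => DistribSMul.toAddMonoidHom E (r ^ i)

theorem pev_apply (r : ℂ[X]) (p : ℕ →₀ E) : pev r p = p.sum fun i c => r ^ i • c := rfl

theorem pev_single (r : ℂ[X]) (i : ℕ) (c : E) :
    pev r (Finsupp.single i c) = r ^ i • c := by
  simp [pev]

theorem eq_zero_of_cev (p : ℕ →₀ E) (h : ∀ lam : ℂ, cev lam p = 0) : p = 0 := by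
  ext i
  rw [Finsupp.zero_apply, ← Module.forall_dual_apply_eq_zero_iff ℂ]
  intro φ
  have hq : (∑ j ∈ p.support, monomial j (φ (p j)) : ℂ[X]) = 0 := by
    apply Polynomial.funext
    intro lam
    have := congrArg φ (h lam)
    simp only [cev, Finsupp.sum, map_sum, map_smul, smul_eq_mul, map_zero] at this
    simp only [eval_finsetSum, eval_monomial, eval_zero]
    rw [← this]
    exact Finset.sum_congr rfl fun _ _ => mul_comm _ _
  have := congrArg (fun q => q.coeff i) hq
  simp only [finsetSum_coeff, coeff_monomial, coeff_zero, Finset.sum_ite_eq'] at this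
  by_cases hi : i ∈ p.support
  · simpa [hi] using this
  · rw [Finsupp.notMem_support_iff.mp hi, map_zero]

def IsPoly (F : ℂ[X] → E) : Prop := ∃ p : ℕ →₀ E, ∀ r, F r = pev r p

theorem IsPoly.pev (p : ℕ →₀ E) : IsPoly fun r => pev r p := ⟨p, fun _ => rfl⟩

theorem IsPoly.zero : IsPoly (fun _ => (0 : E)) := ⟨0, fun r => by simp⟩

theorem IsPoly.add {F G : ℂ[X] → E} (hF : IsPoly F) (hG : IsPoly G) :
    IsPoly fun r => F r + G r := by
  obtain ⟨p, hp⟩ := hF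
  obtain ⟨q, hq⟩ := hG
  exact ⟨p + q, fun r => by simp [hp, hq]⟩

theorem IsPoly.sum {ι : Type*} (s : Finset ι) {F : ι → ℂ[X] → E} (hF : ∀ i, IsPoly (F i)) :
    IsPoly fun r => ∑ i ∈ s, F i r := by
  classical
  induction s using Finset.induction_on with
  | empty => simpa using IsPoly.zero
  | insert i s hi ih => simpa [Finset.sum_insert hi] using (hF i).add ih

theorem IsPoly.csmul (g : ℂ[X]) {F : ℂ[X] → E} (hF : IsPoly F) :
    IsPoly fun r => g • F r := by
  obtain ⟨p, hp⟩ := hF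
  refine ⟨p.mapRange (fun e => g • e) (smul_zero g), fun r => ?_⟩
  beta_reduce
  rw [hp, pev_apply, pev_apply, Finsupp.sum_mapRange_index (by simp), Finsupp.smul_sum]
  simp only [Finsupp.sum, smul_smul, mul_comm]

theorem IsPoly.rsmul {F : ℂ[X] → E} (hF : IsPoly F) :
    IsPoly fun r => r • F r := by
  obtain ⟨p, hp⟩ := hF
  refine ⟨p.sum fun i c => Finsupp.single (i + 1) c, fun r => ?_⟩
  beta_reduce
  rw [hp, Finsupp.sum, map_sum, pev_apply, Finsupp.smul_sum]
  simp only [Finsupp.sum, pev_single, smul_smul, pow_succ, mul_comm]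

theorem IsPoly.affine (g : ℂ[X]) {F : ℂ[X] → E} (hF : IsPoly F) :
    IsPoly fun r => (r + g) • F r := by
  simpa only [add_smul] using hF.rsmul.add (hF.csmul g)

theorem IsPoly.affine_pow (g : ℂ[X]) {F : ℂ[X] → E} (hF : IsPoly F) (n : ℕ) :
    IsPoly fun r => (r + g) ^ n • F r := by
  induction n with
  | zero => simpa using hF
  | succ n ih => simpa only [pow_succ', mul_smul] using ih.affine g

theorem IsPoly.const (e : E) : IsPoly fun _ => e :=
  ⟨Finsupp.single 0 e, fun r => by simp [pev_single]⟩

theorem IsPoly.pev_affine (g : ℂ[X]) (p : ℕ →₀ E) :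
    IsPoly fun r => Stmt5Aux.pev (r + g) p :=
  IsPoly.sum p.support fun i => (IsPoly.const (p i)).affine_pow g i

variable [IsScalarTower ℂ ℂ[X] E]

theorem C_smul' (lam : ℂ) (e : E) : (C lam : ℂ[X]) • e = lam • e := by
  rw [← algebraMap_eq, algebraMap_smul]

theorem cev_eq (lam : ℂ) (p : ℕ →₀ E) : cev lam p = pev (C lam) p := by
  simp only [cev, pev_apply, ← C_pow, C_smul']

theorem IsPoly.eq {F G : ℂ[X] → E} (hF : IsPoly F) (hG : IsPoly G)
    (h : ∀ lam : ℂ, F (C lam) = G (C lam)) (r : ℂ[X]) : F r = G r := by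
  obtain ⟨p, hp⟩ := hF
  obtain ⟨q, hq⟩ := hG
  have : p - q = 0 := eq_zero_of_cev _ fun lam => by
    rw [cev_eq, map_sub, ← hp, ← hq, h, sub_self]
  rw [hp, hq, sub_eq_zero.mp this]

def pm (f : ConfBilin E E E) (r : ℂ[X]) (a b : E) : E := pev r (f.coeff a b)

variable (f g : ConfBilin E E E)

theorem mul_eq (lam : ℂ) (a b : E) : f.mul lam a b = pm f (C lam) a b := cev_eq _ _

theorem mulNeg_eq (lam : ℂ) (a b : E) : f.mulNeg lam a b = pm f (-(C lam) - X) a b := rfl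

theorem pm_add_left (r : ℂ[X]) (a a' b : E) : pm f r (a + a') b = pm f r a b + pm f r a' b := by
  simp [pm, f.add_left]

theorem pm_add_right (r : ℂ[X]) (a b b' : E) : pm f r a (b + b') = pm f r a b + pm f r a b' := by
  simp [pm, f.add_right]

def pmL (r : ℂ[X]) (b : E) : E →+ E := AddMonoidHom.mk' (fun a => pm f r a b)
  fun _ _ => pm_add_left f r _ _ _
def pmR (r : ℂ[X]) (a : E) : E →+ E := AddMonoidHom.mk' (fun b => pm f r a b)
  fun _ _ => pm_add_right f r _ _ _

theorem pm_sub_left (r : ℂ[X]) (a a' b : E) : pm f r (a - a') b = pm f r a b - pm f r a' b :=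
  map_sub (pmL f r b) a a'
theorem pm_sub_right (r : ℂ[X]) (a b b' : E) : pm f r a (b - b') = pm f r a b - pm f r a b' :=
  map_sub (pmR f r a) b b'

theorem isPoly_pm (a b : E) : IsPoly fun r => pm f r a b := IsPoly.pev _

theorem pm_C_left (r : ℂ[X]) (c : ℂ) (a b : E) :
    pm f r ((C c : ℂ[X]) • a) b = (C c : ℂ[X]) • pm f r a b := by
  refine IsPoly.eq (isPoly_pm f _ b) ((isPoly_pm f a b).csmul (C c)) (fun lam => ?_) r
  rw [C_smul', C_smul', ← mul_eq, ← mul_eq, ConfBilin.mul, f.smul_left, ConfBilin.mul, cev, cev,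
    Finsupp.sum_smul_index' (by simp), Finsupp.smul_sum]
  simp only [smul_comm c]

theorem pm_C_right (r : ℂ[X]) (c : ℂ) (a b : E) :
    pm f r a ((C c : ℂ[X]) • b) = (C c : ℂ[X]) • pm f r a b := by
  refine IsPoly.eq (isPoly_pm f a _) ((isPoly_pm f a b).csmul (C c)) (fun lam => ?_) r
  rw [C_smul', C_smul', ← mul_eq, ← mul_eq, ConfBilin.mul, f.smul_right, ConfBilin.mul, cev, cev,
    Finsupp.sum_smul_index' (by simp), Finsupp.smul_sum]
  simp only [smul_comm c]

theorem pm_X_left (r : ℂ[X]) (a b : E) :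
    pm f r ((X : ℂ[X]) • a) b = (-r) • pm f r a b := by
  refine IsPoly.eq (isPoly_pm f _ b) (G := fun r => (-r) • pm f r a b) ?_ (fun lam => ?_) r
  · have := (isPoly_pm f a b).rsmul.csmul (-1)
    simpa only [neg_smul, one_smul] using this
  · have := f.sesq_left lam a b
    rw [cev_eq, cev_eq, ← C_smul', C_neg] at this
    exact this

theorem pm_X_right (r : ℂ[X]) (a b : E) :
    pm f r a ((X : ℂ[X]) • b) = (X + r) • pm f r a b := by
  refine IsPoly.eq (isPoly_pm f a _) (G := fun r => (X + r) • pm f r a b) ?_ (fun lam => ?_) r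
  · simpa only [add_comm X] using (isPoly_pm f a b).affine X
  · have := f.sesq_right lam a b
    rw [cev_eq, cev_eq, ← C_smul', ← add_smul] at this
    exact this

theorem pm_smul_left (r p : ℂ[X]) (a b : E) :
    pm f r (p • a) b = p.comp (-r) • pm f r a b := by
  induction p using Polynomial.induction_on with
  | C c => rw [C_comp, pm_C_left]
  | add p q hp hq => rw [add_smul, pm_add_left, hp, hq, add_comp, add_smul]
  | monomial n c h =>
    rw [pow_succ, ← mul_assoc, mul_comm, mul_smul, pm_X_left, h, mul_comp X, X_comp, mul_smul]

theorem pm_smul_right (r p : ℂ[X]) (a b : E) :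
    pm f r a (p • b) = p.comp (X + r) • pm f r a b := by
  induction p using Polynomial.induction_on with
  | C c => rw [C_comp, pm_C_right]
  | add p q hp hq => rw [add_smul, pm_add_right, hp, hq, add_comp, add_smul]
  | monomial n c h =>
    rw [pow_succ, ← mul_assoc, mul_comm, mul_smul, pm_X_right, h, mul_comp X, X_comp, mul_smul]

theorem pm_pm_left (s r : ℂ[X]) (x y c : E) :
    pm f s (pm g r x y) c =
      ∑ i ∈ (g.coeff x y).support, (r.comp (-s)) ^ i • pm f s (g.coeff x y i) c := by
  have := map_sum (pmL f s c) (fun i => r ^ i • g.coeff x y i) (g.coeff x y).support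
  refine Eq.trans this (Finset.sum_congr rfl fun i _ => ?_)
  exact (pm_smul_left f s _ _ _).trans (by rw [pow_comp])

theorem pm_pm_right (s r : ℂ[X]) (x y c : E) :
    pm f s c (pm g r x y) =
      ∑ i ∈ (g.coeff x y).support, (r.comp (X + s)) ^ i • pm f s c (g.coeff x y i) := by
  have := map_sum (pmR f s c) (fun i => r ^ i • g.coeff x y i) (g.coeff x y).support
  refine Eq.trans this (Finset.sum_congr rfl fun i _ => ?_)
  exact (pm_smul_right f s _ _ _).trans (by rw [pow_comp])

variable (D : DendriformConfAlg E)

theorem dd2 (lam mu : ℂ) (a b c : E) :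
    pm D.prec (-(C lam) - X) (pm D.prec (-(C mu) - X) c b) a =
      pm D.prec (-(C (lam + mu)) - X) c (pm D.succ (C mu) b a)
        + pm D.prec (-(C (lam + mu)) - X) c (pm D.prec (C mu) b a) := by
  have key := IsPoly.eq
    (F := fun r => ∑ i ∈ (D.prec.coeff c b).support,
      r ^ i • pm D.prec (r + C mu) (D.prec.coeff c b i) a)
    (G := fun r => pm D.prec r c (pm D.succ (C mu) b a + pm D.prec (C mu) b a))
    (IsPoly.sum _ fun i => by
      simpa only [add_zero, pm] using
        (IsPoly.pev_affine (C mu) (D.prec.coeff (D.prec.coeff c b i) a)).affine_pow 0 i)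
    (isPoly_pm _ _ _)
    (fun nu => by
      have := D.dend2 nu mu c b a
      simp only [mul_eq] at this
      rw [← this, pm_pm_left]
      simp)
    (-(C (lam + mu)) - X)
  rw [← pm_add_right]
  refine Eq.trans ?_ key
  rw [pm_pm_left]
  have h1 : (-(C (lam + mu)) - X : ℂ[X]) + C mu = -(C lam) - X := by
    rw [C_add]; ring
  have h2 : (-(C mu) - X : ℂ[X]).comp (-(-(C lam) - X)) = -(C (lam + mu)) - X := by
    simp; ring
  simp only [h1, h2]

theorem dd3 (lam mu : ℂ) (a b c : E) :
    pm D.succ (C lam) a (pm D.prec (-(C mu) - X) c b) =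
      pm D.prec (-(C mu) - X) (pm D.succ (C lam) a c) b := by
  have key := IsPoly.eq
    (F := fun r => ∑ i ∈ (D.prec.coeff c b).support,
      (r + -(C lam)) ^ i • pm D.succ (C lam) a (D.prec.coeff c b i))
    (G := fun r => pm D.prec r (pm D.succ (C lam) a c) b)
    (IsPoly.sum _ fun i => (IsPoly.const _).affine_pow _ i)
    (isPoly_pm _ _ _)
    (fun nu => by
      have := D.dend3 lam (nu - lam) a c b
      simp only [mul_eq, add_sub_cancel] at this
      rw [this, pm_pm_right]
      simp [sub_eq_add_neg])
    (-(C mu) - X)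
  refine Eq.trans ?_ key
  rw [pm_pm_right]
  have h2 : (-(C mu) - X : ℂ[X]).comp (X + C lam) = (-(C mu) - X) + -(C lam) := by
    simp; ring
  simp only [h2]

theorem dd1 (lam mu : ℂ) (a b c : E) :
    pm D.succ (C (lam + mu)) (pm D.prec (-(C lam) - X) b a) c =
      pm D.succ (C (lam + mu)) (pm D.prec (C mu) b a) c := by
  rw [pm_pm_left, pm_pm_left]
  have h : (-(C lam) - X : ℂ[X]).comp (-(C (lam + mu))) = (C mu : ℂ[X]).comp (-(C (lam + mu))) := by
    simp
  rw [h]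

theorem dd4 (lam mu : ℂ) (a b c : E) :
    pm D.prec (-(C (lam + mu)) - X) c (pm D.prec (-(C lam) - X) b a) =
      pm D.prec (-(C (lam + mu)) - X) c (pm D.prec (C mu) b a) := by
  rw [pm_pm_right, pm_pm_right]
  have h : (-(C lam) - X : ℂ[X]).comp (X + (-(C (lam + mu)) - X)) =
      (C mu : ℂ[X]).comp (X + (-(C (lam + mu)) - X)) := by
    simp
  rw [h]

theorem dc_eq (lam : ℂ) (a b : E) :
    dendComp D lam a b = pm D.succ (C lam) a b - pm D.prec (-(C lam) - X) b a := by
  rw [dendComp, mul_eq, mulNeg_eq]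

theorem half (lam mu : ℂ) (a b c : E) :
    dendComp D (lam + mu) (dendComp D lam a b) c - dendComp D lam a (dendComp D mu b c) =
      pm D.prec (-(C mu) - X) (pm D.succ (C lam) a c) b
      + pm D.prec (-(C lam) - X) (pm D.succ (C mu) b c) a
      - pm D.succ (C (lam + mu)) (pm D.prec (C mu) b a) c
      - pm D.succ (C (lam + mu)) (pm D.prec (C lam) a b) c
      - pm D.prec (-(C (lam + mu)) - X) c (pm D.succ (C lam) a b)
      - pm D.prec (-(C (lam + mu)) - X) c (pm D.succ (C mu) b a) := by
  have h := D.dend1 lam mu a b c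
  simp only [mul_eq, pm_add_left] at h
  simp only [dc_eq, pm_sub_left, pm_sub_right, dd1, dd2, dd3, dd4, h]
  abel

end

end Stmt5Aux

/-- for a dendriform conformal algebra `(E, ≻, ≺)`, the product
`a ∘_λ b = a ≻_λ b - b ≺_{-λ-∂} a` is conformal sesquilinear and makes `E`
a left-symmetric conformal algebra. -/
theorem stmt5 {E : Type*}
    [AddCommGroup E] [Module ℂ E] [Module ℂ[X] E] [IsScalarTower ℂ ℂ[X] E]
    (D : DendriformConfAlg E) :
    (∀ (lam : ℂ) (a b : E),
        dendComp D lam ((X : ℂ[X]) • a) b = (-lam) • dendComp D lam a b) ∧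
    (∀ (lam : ℂ) (a b : E),
        dendComp D lam a ((X : ℂ[X]) • b) =
          (X : ℂ[X]) • dendComp D lam a b + lam • dendComp D lam a b) ∧
    (∀ (lam mu : ℂ) (a b c : E),
        dendComp D (lam + mu) (dendComp D lam a b) c - dendComp D lam a (dendComp D mu b c) =
          dendComp D (lam + mu) (dendComp D mu b a) c - dendComp D mu b (dendComp D lam a c)) := by
  refine ⟨fun lam a b => ?_, fun lam a b => ?_, fun lam mu a b c => ?_⟩
  · rw [Stmt5Aux.dc_eq, Stmt5Aux.dc_eq, Stmt5Aux.pm_X_left, Stmt5Aux.pm_X_right,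
      ← Stmt5Aux.C_smul', C_neg, smul_sub]
    congr 2
    ring
  · rw [Stmt5Aux.dc_eq, Stmt5Aux.dc_eq, Stmt5Aux.pm_X_left, Stmt5Aux.pm_X_right,
      ← Stmt5Aux.C_smul', ← add_smul, smul_sub]
    congr 2
    ring
  · rw [Stmt5Aux.half, add_comm lam mu, Stmt5Aux.half]
    abel
end
end

section
/- Let A be an associative conformal algebra, M a conformal bimodule over A, φ a 2-cocycle in C²(A,M), and T : M → A a ℂ[∂]-module homomorphism. Then T is a φ-Rota-Baxter operator if and only if the graph Gr(T) = {(T(m), m) : m ∈ M} is a subalgebra of A ⊕_φ M, i.e., for all m, n ∈ M every coefficient of the polynomial (T(m), m) ∘^φ_λ (T(n), n) lies in Gr(T). -/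
open Polynomial

noncomputable section

theorem cev_map' {V W : Type*} [AddCommGroup V] [Module ℂ V] [AddCommGroup W] [Module ℂ W]
    (f : V →ₗ[ℂ] W) (lam : ℂ) (p : ℕ →₀ V) :
    cev lam (Finsupp.mapRange f f.map_zero p) = f (cev lam p) := by
  unfold cev
  rw [Finsupp.sum_mapRange_index (by simp), map_finsuppSum]
  simp

theorem cev_eq_zero' {V : Type*} [AddCommGroup V] [Module ℂ V] (p : ℕ →₀ V)
    (h : ∀ lam : ℂ, cev lam p = 0) : p = 0 := by
  ext i
  rw [Finsupp.zero_apply, ← Module.forall_dual_apply_eq_zero_iff ℂ]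
  intro f
  let P : ℂ[X] := p.sum fun i c => monomial i (f c)
  have hP : P = 0 := by
    apply Polynomial.funext
    intro r
    have := congrArg f (h r)
    unfold cev at this
    rw [map_finsuppSum, map_zero] at this
    simp only [map_smul, smul_eq_mul] at this
    simp only [P, Finsupp.sum, eval_finsetSum, eval_monomial, eval_zero]
    rw [← this, Finsupp.sum]
    exact Finset.sum_congr rfl fun _ _ => mul_comm _ _
  have := congrArg (fun q => Polynomial.coeff q i) hP
  simp only [P, Finsupp.sum, finsetSum_coeff, coeff_monomial, coeff_zero,
    Finset.sum_ite_eq', Finsupp.mem_support_iff] at this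
  by_cases hi : p i = 0
  · simp [hi]
  · simpa [hi] using this

theorem cev_inj' {V : Type*} [AddCommGroup V] [Module ℂ V] (p q : ℕ →₀ V)
    (h : ∀ lam : ℂ, cev lam p = cev lam q) : p = q := by
  have : p - q = 0 := by
    apply cev_eq_zero'
    intro lam
    have h1 := cev_add' lam (p - q) q
    rw [sub_add_cancel, h lam] at h1
    simpa using h1
  exact sub_eq_zero.mp this

/-- `T` is a `φ`-Rota-Baxter operator iff the graph of `T` is a
subalgebra of the twisted semidirect product `A ⊕_φ M`, i.e. every coefficient
of the polynomial `(T(m), m) ∘^φ_λ (T(n), n)` lies in `Gr(T)`. -/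
theorem stmt7 {A M : Type*}
    [AddCommGroup A] [Module ℂ A] [Module ℂ[X] A] [IsScalarTower ℂ ℂ[X] A]
    [AddCommGroup M] [Module ℂ M] [Module ℂ[X] M] [IsScalarTower ℂ ℂ[X] M]
    (θ : AssocConfAlg A) (ρ : ConfBimod θ M) (φ : ConfBilin A A M)
    (hφ : IsTwoCocycle ρ φ) (T : M →ₗ[ℂ[X]] A) :
    IsTwistedRB ρ φ ⇑T ↔
      ∀ (m n : M) (i : ℕ), ∃ u : M,
        ((θ.coeff (T m) (T n)) i,
          ((ρ.l.coeff (T m) n + ρ.r.coeff m (T n) + φ.coeff (T m) (T n) : ℕ →₀ M)) i)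
            = (T u, u) := by
  let f : M →ₗ[ℂ] A :=
    { toFun := T, map_add' := T.map_add
      map_smul' := fun c x => by
        rw [← one_smul ℂ[X] x, ← smul_assoc, T.map_smul, smul_assoc, T.map_smul]; rfl }
  have key : IsTwistedRB ρ φ ⇑T ↔ ∀ m n : M, θ.coeff (T m) (T n) =
      Finsupp.mapRange f f.map_zero
        (ρ.l.coeff (T m) n + ρ.r.coeff m (T n) + φ.coeff (T m) (T n)) := by
    constructor
    · intro h m n
      apply cev_inj'
      intro lam
      rw [cev_map', cev_add', cev_add']
      exact h lam m n
    · intro h lam m n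
      have := congrArg (cev lam) (h m n)
      rw [cev_map', cev_add', cev_add'] at this
      exact this
  rw [key]
  constructor
  · intro h m n i
    refine ⟨_, Prod.ext ?_ rfl⟩
    exact (DFunLike.congr_fun (h m n) i).trans (Finsupp.mapRange_apply ..)
  · intro h m n
    ext i
    obtain ⟨u, hu⟩ := h m n i
    rw [Prod.mk.injEq] at hu
    rw [Finsupp.mapRange_apply, hu.1, hu.2]
    rfl
end
end

section
/- Let A be an associative conformal algebra, M a conformal bimodule over A, φ a 2-cocycle in C²(A,M), and T : M → A a φ-Rota-Baxter operator. Then M becomes a conformal NS-algebra under the λ-products m ≻_λ n = T(m)_λ n, m ≺_λ n = m_λ T(n), and m ∨_λ n = φ_λ(T(m), T(n)). -/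
open Polynomial

noncomputable section

/-- a `φ`-Rota-Baxter operator `T : M → A` makes `M` a conformal
NS-algebra via `m ≻_λ n = T(m)_λ n`, `m ≺_λ n = m_λ T(n)` and
`m ∨_λ n = φ_λ(T(m), T(n))`. -/
theorem stmt10 {A M : Type*}
    [AddCommGroup A] [Module ℂ A] [Module ℂ[X] A] [IsScalarTower ℂ ℂ[X] A]
    [AddCommGroup M] [Module ℂ M] [Module ℂ[X] M] [IsScalarTower ℂ ℂ[X] M]
    (θ : AssocConfAlg A) (ρ : ConfBimod θ M) (φ : ConfBilin A A M)
    (hφ : IsTwoCocycle ρ φ) (T : M →ₗ[ℂ[X]] A) (hT : IsTwistedRB ρ φ ⇑T) :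
    ∃ NS : NSConfAlg M,
      (∀ (lam : ℂ) (m n : M), NS.succ.mul lam m n = ρ.l.mul lam (T m) n) ∧
      (∀ (lam : ℂ) (m n : M), NS.prec.mul lam m n = ρ.r.mul lam m (T n)) ∧
      (∀ (lam : ℂ) (m n : M), NS.vee.mul lam m n = φ.mul lam (T m) (T n)) := by
  have hc : ∀ (c : ℂ) (m : M), T (c • m) = c • T m := fun c m => by
    rw [← IsScalarTower.algebraMap_smul ℂ[X] c m, map_smul, IsScalarTower.algebraMap_smul]
  let S : ConfBilin M M M :=
    { coeff := fun m n => ρ.l.coeff (T m) n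
      add_left := fun a a' b => by rw [map_add, ρ.l.add_left]
      smul_left := fun c a b => by rw [hc, ρ.l.smul_left]
      add_right := fun a b b' => ρ.l.add_right _ _ _
      smul_right := fun c a b => ρ.l.smul_right _ _ _
      sesq_left := fun lam a b => by rw [map_smul, ρ.l.sesq_left]
      sesq_right := fun lam a b => ρ.l.sesq_right _ _ _ }
  let P : ConfBilin M M M :=
    { coeff := fun m n => ρ.r.coeff m (T n)
      add_left := fun a a' b => ρ.r.add_left _ _ _
      smul_left := fun c a b => ρ.r.smul_left _ _ _
      add_right := fun a b b' => by rw [map_add, ρ.r.add_right]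
      smul_right := fun c a b => by rw [hc, ρ.r.smul_right]
      sesq_left := fun lam a b => ρ.r.sesq_left _ _ _
      sesq_right := fun lam a b => by rw [map_smul, ρ.r.sesq_right] }
  let V : ConfBilin M M M :=
    { coeff := fun m n => φ.coeff (T m) (T n)
      add_left := fun a a' b => by rw [map_add, φ.add_left]
      smul_left := fun c a b => by rw [hc, φ.smul_left]
      add_right := fun a b b' => by rw [map_add, φ.add_right]
      smul_right := fun c a b => by rw [hc, φ.smul_right]
      sesq_left := fun lam a b => by rw [map_smul, φ.sesq_left]
      sesq_right := fun lam a b => by rw [map_smul, φ.sesq_right] }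
  have hS : ∀ (lam : ℂ) (m n : M), S.mul lam m n = ρ.l.mul lam (T m) n := fun _ _ _ => rfl
  have hP : ∀ (lam : ℂ) (m n : M), P.mul lam m n = ρ.r.mul lam m (T n) := fun _ _ _ => rfl
  have hV : ∀ (lam : ℂ) (m n : M), V.mul lam m n = φ.mul lam (T m) (T n) := fun _ _ _ => rfl
  refine ⟨⟨S, P, V, ?_, ?_, ?_, ?_⟩, hS, hP, hV⟩
  · intro lam mu x y z
    simp only [hS, hP, hV]
    rw [← hT, ρ.assoc_ll]
  · intro lam mu x y z
    simp only [hS, hP, hV]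
    rw [← hT, ρ.assoc_rr]
  · intro lam mu x y z
    simp only [hS, hP]
    rw [ρ.assoc_lr]
  · intro lam mu x y z
    simp only [hS, hP, hV]
    rw [← hT, ← hT]
    have h := hφ lam mu (T x) (T y) (T z)
    rw [sub_eq_zero] at h
    rw [← h]
    abel
end
end

section
/- Let A be an associative conformal algebra, M a conformal bimodule over A, φ a 2-cocycle in C²(A,M), and T : M → A a φ-Rota-Baxter operator. Then the λ-product m ⋆^φ_λ n = T(m)_λ n + m_λ T(n) + φ_λ(T(m), T(n)) makes M an associative conformal algebra M^φ_ass, and the λ-actions m ·^φ_λ a = T(m)_λ a − T(m_λ a + φ_λ(T(m), a)) and a ·^φ_λ m = a_λ T(m) − T(a_λ m + φ_λ(a, T(m))) make A a conformal bimodule over M^φ_ass. -/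
open Polynomial

noncomputable section

section Helpers

variable {A B M : Type*}
  [AddCommGroup A] [Module ℂ A] [Module ℂ[X] A]
  [AddCommGroup B] [Module ℂ B] [Module ℂ[X] B]
  [AddCommGroup M] [Module ℂ M] [Module ℂ[X] M]

theorem mul_add_left' (f : ConfBilin A B M) (lam : ℂ) (a a' : A) (b : B) :
    f.mul lam (a + a') b = f.mul lam a b + f.mul lam a' b := by
  simp [ConfBilin.mul, f.add_left, cev_add']

theorem mul_add_right' (f : ConfBilin A B M) (lam : ℂ) (a : A) (b b' : B) :
    f.mul lam a (b + b') = f.mul lam a b + f.mul lam a b' := by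
  simp [ConfBilin.mul, f.add_right, cev_add']

theorem mul_sub_left' (f : ConfBilin A B M) (lam : ℂ) (a a' : A) (b : B) :
    f.mul lam (a - a') b = f.mul lam a b - f.mul lam a' b := by
  rw [eq_sub_iff_add_eq, ← mul_add_left', sub_add_cancel]

theorem mul_sub_right' (f : ConfBilin A B M) (lam : ℂ) (a : A) (b b' : B) :
    f.mul lam a (b - b') = f.mul lam a b - f.mul lam a b' := by
  rw [eq_sub_iff_add_eq, ← mul_add_right', sub_add_cancel]

theorem mul_X_left' (f : ConfBilin A B M) (lam : ℂ) (a : A) (b : B) :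
    f.mul lam ((X : ℂ[X]) • a) b = (-lam) • f.mul lam a b := f.sesq_left lam a b

theorem mul_X_right' (f : ConfBilin A B M) (lam : ℂ) (a : A) (b : B) :
    f.mul lam a ((X : ℂ[X]) • b) = (X : ℂ[X]) • f.mul lam a b + lam • f.mul lam a b :=
  f.sesq_right lam a b

end Helpers

/-- for a `φ`-Rota-Baxter operator `T`, the product
`m ⋆^φ_λ n = T(m)_λ n + m_λ T(n) + φ_λ(T(m),T(n))` makes `M` an associative
conformal algebra `M^φ_ass`, and the twisted actions
`m ·^φ_λ a = T(m)_λ a - T(m_λ a + φ_λ(T(m),a))`,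
`a ·^φ_λ m = a_λ T(m) - T(a_λ m + φ_λ(a,T(m)))` make `A` a conformal
bimodule over `M^φ_ass`. -/
theorem stmt11 {A M : Type*}
    [AddCommGroup A] [Module ℂ A] [Module ℂ[X] A] [IsScalarTower ℂ ℂ[X] A]
    [AddCommGroup M] [Module ℂ M] [Module ℂ[X] M] [IsScalarTower ℂ ℂ[X] M]
    (θ : AssocConfAlg A) (ρ : ConfBimod θ M) (φ : ConfBilin A A M)
    (hφ : IsTwoCocycle ρ φ) (T : M →ₗ[ℂ[X]] A) (hT : IsTwistedRB ρ φ ⇑T) :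
    -- `⋆^φ` is conformal sesquilinear and associative
    (∀ (lam : ℂ) (m n : M),
        twStar ρ φ (⇑T) lam ((X : ℂ[X]) • m) n = (-lam) • twStar ρ φ (⇑T) lam m n) ∧
    (∀ (lam : ℂ) (m n : M),
        twStar ρ φ (⇑T) lam m ((X : ℂ[X]) • n) =
          (X : ℂ[X]) • twStar ρ φ (⇑T) lam m n + lam • twStar ρ φ (⇑T) lam m n) ∧
    (∀ (lam mu : ℂ) (m n p : M),
        twStar ρ φ (⇑T) (lam + mu) (twStar ρ φ (⇑T) lam m n) p =
          twStar ρ φ (⇑T) lam m (twStar ρ φ (⇑T) mu n p)) ∧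
    -- the two actions are conformal sesquilinear
    (∀ (lam : ℂ) (m : M) (a : A),
        twDotL ρ φ (⇑T) lam ((X : ℂ[X]) • m) a = (-lam) • twDotL ρ φ (⇑T) lam m a) ∧
    (∀ (lam : ℂ) (m : M) (a : A),
        twDotL ρ φ (⇑T) lam m ((X : ℂ[X]) • a) =
          (X : ℂ[X]) • twDotL ρ φ (⇑T) lam m a + lam • twDotL ρ φ (⇑T) lam m a) ∧
    (∀ (lam : ℂ) (a : A) (m : M),
        twDotR ρ φ (⇑T) lam ((X : ℂ[X]) • a) m = (-lam) • twDotR ρ φ (⇑T) lam a m) ∧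
    (∀ (lam : ℂ) (a : A) (m : M),
        twDotR ρ φ (⇑T) lam a ((X : ℂ[X]) • m) =
          (X : ℂ[X]) • twDotR ρ φ (⇑T) lam a m + lam • twDotR ρ φ (⇑T) lam a m) ∧
    -- conformal bimodule axioms
    (∀ (lam mu : ℂ) (m n : M) (a : A),
        twDotL ρ φ (⇑T) lam m (twDotL ρ φ (⇑T) mu n a) =
          twDotL ρ φ (⇑T) (lam + mu) (twStar ρ φ (⇑T) lam m n) a) ∧
    (∀ (lam mu : ℂ) (a : A) (m n : M),
        twDotR ρ φ (⇑T) (lam + mu) (twDotR ρ φ (⇑T) lam a m) n =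
          twDotR ρ φ (⇑T) lam a (twStar ρ φ (⇑T) mu m n)) ∧
    (∀ (lam mu : ℂ) (m : M) (a : A) (n : M),
        twDotL ρ φ (⇑T) lam m (twDotR ρ φ (⇑T) mu a n) =
          twDotR ρ φ (⇑T) (lam + mu) (twDotL ρ φ (⇑T) lam m a) n) := by
  have hθ : ∀ lam a b, θ.mul lam a b = θ.toConfBilin.mul lam a b := fun _ _ _ => rfl
  have hTs : ∀ (c : ℂ) (m : M), T (c • m) = c • T m := fun c m => by
    rw [← IsScalarTower.algebraMap_smul ℂ[X] c m, ← IsScalarTower.algebraMap_smul ℂ[X] c (T m),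
      map_smul]
  have hst : ∀ (lam : ℂ) (m n : M),
      T (twStar ρ φ (⇑T) lam m n) = θ.mul lam (T m) (T n) := fun lam m n => (hT lam m n).symm
  refine ⟨?_, ?_, ?_, ?_, ?_, ?_, ?_, ?_, ?_, ?_⟩
  · intro lam m n
    simp only [twStar, map_smul, mul_X_left', smul_add]
  · intro lam m n
    simp only [twStar, map_smul, mul_X_right', smul_add]
    abel
  · intro lam mu m n p
    have hc := hφ lam mu (T m) (T n) (T p)
    have e1 : twStar ρ φ (⇑T) (lam + mu) (twStar ρ φ (⇑T) lam m n) p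
      = ρ.l.mul (lam + mu) (θ.mul lam (T m) (T n)) p
        + ρ.r.mul (lam + mu) (twStar ρ φ (⇑T) lam m n) (T p)
        + φ.mul (lam + mu) (θ.mul lam (T m) (T n)) (T p) := by
      rw [← hst]; rfl
    have e2 : twStar ρ φ (⇑T) lam m (twStar ρ φ (⇑T) mu n p)
      = ρ.l.mul lam (T m) (twStar ρ φ (⇑T) mu n p)
        + ρ.r.mul lam m (θ.mul mu (T n) (T p))
        + φ.mul lam (T m) (θ.mul mu (T n) (T p)) := by
      rw [← hst]; rfl
    rw [e1, e2]
    simp only [twStar, mul_add_left', mul_add_right', ρ.assoc_ll, ρ.assoc_lr, ρ.assoc_rr]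
    rw [← sub_eq_zero, ← neg_eq_zero, ← hc]
    abel
  · intro lam m a
    simp only [twDotL, hθ, map_smul, mul_X_left', ← smul_add, hTs, smul_sub]
  · intro lam m a
    simp only [twDotL, hθ, map_smul, map_add, mul_X_right', smul_add, hTs, smul_sub]
    abel
  · intro lam a m
    simp only [twDotR, hθ, map_smul, mul_X_left', ← smul_add, hTs, smul_sub]
  · intro lam a m
    simp only [twDotR, hθ, map_smul, map_add, mul_X_right', smul_add, hTs, smul_sub]
    abel
  · intro lam mu m n a
    have hc := congrArg T (hφ lam mu (T m) (T n) a)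
    have ha := θ.assoc lam mu (T m) (T n) a
    have e2 : twDotL ρ φ (⇑T) (lam + mu) (twStar ρ φ (⇑T) lam m n) a
      = θ.mul (lam + mu) (θ.mul lam (T m) (T n)) a
        - T (ρ.r.mul (lam + mu) (twStar ρ φ (⇑T) lam m n) a
        + φ.mul (lam + mu) (θ.mul lam (T m) (T n)) a) := by
      rw [← hst]; rfl
    have hu := hT lam m (ρ.r.mul mu n a + φ.mul mu (T n) a)
    rw [e2]
    simp only [twDotL, twStar, hθ, mul_add_left', mul_add_right', mul_sub_right', map_add,
      map_sub, map_zero, ρ.assoc_lr, ρ.assoc_rr, ha] at hu hc ⊢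
    rw [hu, ← sub_eq_zero, ← neg_eq_zero, ← hc]
    abel
  · intro lam mu a m n
    have hc := congrArg T (hφ lam mu a (T m) (T n))
    have ha := θ.assoc lam mu a (T m) (T n)
    have e2 : twDotR ρ φ (⇑T) lam a (twStar ρ φ (⇑T) mu m n)
      = θ.mul lam a (θ.mul mu (T m) (T n))
        - T (ρ.l.mul lam a (twStar ρ φ (⇑T) mu m n)
        + φ.mul lam a (θ.mul mu (T m) (T n))) := by
      rw [← hst]; rfl
    have h1 := ρ.assoc_ll lam mu a (T m) n
    have hu := hT (lam + mu) (ρ.l.mul lam a m + φ.mul lam a (T m)) n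
    rw [e2]
    simp only [twDotR, twStar, hθ, mul_add_left', mul_add_right', mul_sub_left', map_add,
      map_sub, map_zero, ρ.assoc_lr] at hu hc h1 ⊢
    rw [hu, ha, h1, ← sub_eq_zero, ← hc]
    abel
  · intro lam mu m a n
    have hc := congrArg T (hφ lam mu (T m) a (T n))
    have ha := θ.assoc lam mu (T m) a (T n)
    have hu := hT lam m (ρ.l.mul mu a n + φ.mul mu a (T n))
    have hv := hT (lam + mu) (ρ.r.mul lam m a + φ.mul lam (T m) a) n
    have h1 := ρ.assoc_ll lam mu (T m) a n
    have h2 := ρ.assoc_rr lam mu m a (T n)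
    simp only [twDotL, twDotR, hθ, mul_add_left', mul_add_right', mul_sub_left',
      mul_sub_right', map_add, map_sub, map_zero] at hu hv hc h1 h2 ⊢
    rw [hu, hv, ha, h1, h2, ← sub_eq_zero, ← neg_eq_zero, ← hc]
    abel
end
end

section
/- Let N : A → A be a ℂ[∂]-module homomorphism on an associative conformal algebra A. Then: (i) if N² = 0, then N is a Nijenhuis operator if and only if N is a Rota-Baxter operator of weight 0; (ii) if N² = N, then N is a Nijenhuis operator if and only if N is a Rota-Baxter operator of weight −1; (iii) if N² = id, then N is a Nijenhuis operator if and only if N + id is a Rota-Baxter operator of weight −2, and equivalently if and only if N − id is a Rota-Baxter operator of weight 2. -/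
open Polynomial

noncomputable section

theorem AssocConfAlg.mul_add_left' {A : Type*} [AddCommGroup A] [Module ℂ A] [Module ℂ[X] A]
    (θ : AssocConfAlg A) (l : ℂ) (a a' b : A) :
    θ.mul l (a + a') b = θ.mul l a b + θ.mul l a' b := by
  simp only [AssocConfAlg.mul, ConfBilin.mul, cev, θ.add_left]
  exact Finsupp.sum_add_index' (by simp) (by simp)

theorem AssocConfAlg.mul_add_right' {A : Type*} [AddCommGroup A] [Module ℂ A] [Module ℂ[X] A]
    (θ : AssocConfAlg A) (l : ℂ) (a b b' : A) :
    θ.mul l a (b + b') = θ.mul l a b + θ.mul l a b' := by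
  simp only [AssocConfAlg.mul, ConfBilin.mul, cev, θ.add_right]
  exact Finsupp.sum_add_index' (by simp) (by simp)

theorem AssocConfAlg.mul_sub_left' {A : Type*} [AddCommGroup A] [Module ℂ A] [Module ℂ[X] A]
    (θ : AssocConfAlg A) (l : ℂ) (a a' b : A) :
    θ.mul l (a - a') b = θ.mul l a b - θ.mul l a' b := by
  rw [eq_sub_iff_add_eq, ← θ.mul_add_left', sub_add_cancel]

theorem AssocConfAlg.mul_sub_right' {A : Type*} [AddCommGroup A] [Module ℂ A] [Module ℂ[X] A]
    (θ : AssocConfAlg A) (l : ℂ) (a b b' : A) :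
    θ.mul l a (b - b') = θ.mul l a b - θ.mul l a b' := by
  rw [eq_sub_iff_add_eq, ← θ.mul_add_right', sub_add_cancel]

/-- (i) if `N² = 0` then `N` is Nijenhuis iff `N` is Rota-Baxter of
weight `0`; (ii) if `N² = N` then `N` is Nijenhuis iff `N` is Rota-Baxter of
weight `-1`; (iii) if `N² = id` then `N` is Nijenhuis iff `N + id` is
Rota-Baxter of weight `-2`, and equivalently iff `N - id` is Rota-Baxter of
weight `2`. -/
theorem stmt13 {A : Type*}
    [AddCommGroup A] [Module ℂ A] [Module ℂ[X] A] [IsScalarTower ℂ ℂ[X] A]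
    (θ : AssocConfAlg A) (N : A →ₗ[ℂ[X]] A) :
    ((N ∘ₗ N = 0) → (IsNijenhuis θ ⇑N ↔ IsRotaBaxterWt θ 0 ⇑N)) ∧
    ((N ∘ₗ N = N) → (IsNijenhuis θ ⇑N ↔ IsRotaBaxterWt θ (-1) ⇑N)) ∧
    ((N ∘ₗ N = LinearMap.id) →
      ((IsNijenhuis θ ⇑N ↔ IsRotaBaxterWt θ (-2) (fun a => N a + a)) ∧
       (IsNijenhuis θ ⇑N ↔ IsRotaBaxterWt θ 2 (fun a => N a - a)))) := by
  refine ⟨fun h => ?_, fun h => ?_, fun h => ⟨?_, ?_⟩⟩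
  all_goals
    have hN : ∀ x, N (N x) = _ := fun x => LinearMap.congr_fun h x
    refine forall_congr' fun l => forall_congr' fun a => forall_congr' fun b => ?_
  · simp [hN]
  · simp [hN, sub_eq_add_neg]
  · simp only [θ.mul_add_left', θ.mul_add_right', neg_smul, two_smul, map_add, map_sub, map_neg,
      hN, LinearMap.id_apply]
    rw [← sub_eq_zero]
    conv_rhs => rw [← sub_eq_zero]
    refine Eq.congr ?_ rfl
    abel
  · simp only [θ.mul_sub_left', θ.mul_sub_right', two_smul, map_add, map_sub, map_neg,
      hN, LinearMap.id_apply]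
    rw [← sub_eq_zero]
    conv_rhs => rw [← sub_eq_zero]
    refine Eq.congr ?_ rfl
    abel
end
end
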